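/- arXiv:math/0206263 — 2 statements merged into one kernel-verified Lean document; each statement's English description precedes it below -/
import Mathlib

section
/- Let w be a word of length m and suppose w = f_{i_k}(f_{i_{k−1}}(⋯(f_{i_1}((0,…,0)))⋯)) for some i_1,…,i_k ∈ I, every intermediate application being defined. Then #{t ∈ {1,…,k} : i_t = 0} ≡ N(w) (mod m). In particular, this residue class modulo m does not depend on the chosen sequence i_1,…,i_k. -/
open Finset Polynomial

namespace GreensteinPaths

noncomputable section

attribute [local instance] Classical.propDecidable

variable {ℓ m : ℕ}

/-- The Kashiwara function `R^i_p(w)` (positions are 0-based: index `p` is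
the mathematical position `p+1`, i.e. the `(p+1)`-th tensor factor counted
from the right). -/
def Rf (i : ZMod (ℓ + 1)) (w : Fin m → ZMod (ℓ + 1)) (p : Fin m) : ℤ :=
    (if i = w p then 1 else 0)
  + ∑ s ∈ univ.filter (fun s : Fin m => p < s),
      ((if i = w s then 1 else 0) - (if i = w s + 1 then 1 else 0))

/-- `ε_i(w) = max_p R^i_p(w)` (the maximum is nonnegative for `m ≥ 1`,
so we may record it as a natural number). -/
def eps (i : ZMod (ℓ + 1)) (w : Fin m → ZMod (ℓ + 1)) : ℕ :=
  univ.sup fun p => (Rf i w p).toNat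

/-- `φ_i(w) = ε_i(w) + Σ_s (δ_{i,w_s+1} − δ_{i,w_s})`. -/
def phiW (i : ZMod (ℓ + 1)) (w : Fin m → ZMod (ℓ + 1)) : ℤ :=
  (eps i w : ℤ)
    + ∑ s : Fin m, ((if i = w s + 1 then 1 else 0) - (if i = w s then 1 else 0))

/-- The Kashiwara operator `e_i`, as a partial map: take the largest `p`
with `R^i_p(w) = ε_i(w)`; if `w_p = i`, replace it by `i - 1`, otherwise
the result is undefined. -/
def eOp (i : ZMod (ℓ + 1)) (w : Fin m → ZMod (ℓ + 1)) :
    Option (Fin m → ZMod (ℓ + 1)) :=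
  WithBot.recBotCoe none
    (fun p => if w p = i then some (Function.update w p (i - 1)) else none)
    ((univ.filter fun p => Rf i w p = (eps i w : ℤ)).max)

/-- The Kashiwara operator `f_i`, as a partial map: take the smallest `p`
with `R^i_p(w) = ε_i(w)`; if `w_p = i - 1`, replace it by `i`, otherwise
the result is undefined. -/
def fOp (i : ZMod (ℓ + 1)) (w : Fin m → ZMod (ℓ + 1)) :
    Option (Fin m → ZMod (ℓ + 1)) :=
  WithTop.recTopCoe none
    (fun p => if w p = i - 1 then some (Function.update w p i) else none)
    ((univ.filter fun p => Rf i w p = (eps i w : ℤ)).min)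

/-- The descent set of a word, 0-based: `r ∈ desc w` corresponds to the
mathematical descent `r+1` (i.e. `w_{r+1} > w_{r+2}` in 1-based notation),
letters being compared as integers in `{0,…,ℓ}`. -/
def desc (w : Fin m → ZMod (ℓ + 1)) : Finset (Fin m) :=
  univ.filter fun r : Fin m =>
    ∃ h : (r : ℕ) + 1 < m, (w ⟨(r : ℕ) + 1, h⟩).val < (w r).val

/-- `N(w) = Σ_{r=1}^{k} r (n_r − n_{r−1})` where `0 = n_0 < n_1 < ⋯ < n_{k−1} < n_k = m`
and `n_1 < ⋯ < n_{k−1}` are the descents: equivalently the mathematical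
position `p` (`1 ≤ p ≤ m`) contributes `1` plus the number of descents
strictly below `p`. -/
def Nfun (w : Fin m → ZMod (ℓ + 1)) : ℕ :=
  ∑ p : Fin m, (1 + ((desc w).filter fun r => r < p).card)

/-- The major index: the sum of the descents (which are `r+1` for the
0-based `r ∈ desc w`). -/
def MajFun (w : Fin m → ZMod (ℓ + 1)) : ℕ :=
  ∑ r ∈ desc w, ((r : ℕ) + 1)

/-- Content of a word: `content w j` is the number of positions carrying the letter `j`. -/
def content (w : Fin m → ZMod (ℓ + 1)) (j : ZMod (ℓ + 1)) : ℕ :=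
  (univ.filter fun p => w p = j).card

/-- The affine operator `ê_i` on pairs `(w, c)`. -/
def eHat (i : ZMod (ℓ + 1)) (x : (Fin m → ZMod (ℓ + 1)) × ℤ) :
    Option ((Fin m → ZMod (ℓ + 1)) × ℤ) :=
  (eOp i x.1).map fun w' => (w', x.2 + if i = 0 then 1 else 0)

/-- The affine operator `f̂_i` on pairs `(w, c)`. -/
def fHat (i : ZMod (ℓ + 1)) (x : (Fin m → ZMod (ℓ + 1)) × ℤ) :
    Option ((Fin m → ZMod (ℓ + 1)) × ℤ) :=
  (fOp i x.1).map fun w' => (w', x.2 - if i = 0 then 1 else 0)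

/-- One application of some `ê_i` or `f̂_i`. -/
def hatStep (x y : (Fin m → ZMod (ℓ + 1)) × ℤ) : Prop :=
  ∃ i, eHat i x = some y ∨ fHat i x = some y

/-- `Ô_n`: all pairs obtainable from `((0,…,0), n)` by finitely many
applications of the operators `ê_i`, `f̂_i`. -/
def Ohat (n : ℤ) : Set ((Fin m → ZMod (ℓ + 1)) × ℤ) :=
  {x | Relation.ReflTransGen hatStep ((fun _ => 0), n) x}

/-- Successive application of a partial operator along a list of indices
(the head of the list is applied first); the result is defined only if
every intermediate application is defined. -/
def applyList
    (op : ZMod (ℓ + 1) → (Fin m → ZMod (ℓ + 1)) → Option (Fin m → ZMod (ℓ + 1))) :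
    List (ZMod (ℓ + 1)) → (Fin m → ZMod (ℓ + 1)) → Option (Fin m → ZMod (ℓ + 1))
  | [], w => some w
  | i :: is, w => (op i w).bind (applyList op is)

/-- `n`-fold application of `e_i`. -/
def eIter (i : ZMod (ℓ + 1)) : ℕ → (Fin m → ZMod (ℓ + 1)) → Option (Fin m → ZMod (ℓ + 1))
  | 0, w => some w
  | n + 1, w => (eOp i w).bind (eIter i n)

/-- `φ_n(d) = φ(d)·μ(d/g)/φ(d/g)`, `g = gcd(d,|n|)`. -/
def phiInt (n : ℤ) (d : ℕ) : ℚ :=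
  (Nat.totient d : ℚ) * (ArithmeticFunction.moebius (d / Nat.gcd d n.natAbs) : ℚ)
    / (Nat.totient (d / Nat.gcd d n.natAbs) : ℚ)

/-- The multinomial coefficient `(m/d)! / ((k_0/d)! ⋯ (k_ℓ/d)!)`, with the
convention that it is `0` unless all its entries are (nonnegative) integers. -/
def multinomialQ {ι : Type} [Fintype ι] (M : ℕ) (k : ι → ℕ) (d : ℕ) : ℚ :=
  if d ∣ M ∧ ∀ j, d ∣ k j then
    ((M / d).factorial : ℚ) / ∏ j, ((k j / d).factorial : ℚ)
  else 0

/-- `C(k_0,…,k_ℓ; n) = (1/m) Σ_{d ∣ m} φ_n(d) · multinomial(m/d; k_j/d)`. -/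
def Cfun {ι : Type} [Fintype ι] (M : ℕ) (k : ι → ℕ) (n : ℤ) : ℚ :=
  (1 / (M : ℚ)) * ∑ d ∈ M.divisors, phiInt n d * multinomialQ M k d

/-- `C̃(k_0,…,k_ℓ; d) = (d/m) Σ_{d d' ∣ m} μ(d') · multinomial(m/(dd'); k_j/(dd'))`. -/
def Ctil {ι : Type} [Fintype ι] (M : ℕ) (k : ι → ℕ) (d : ℕ) : ℚ :=
  ((d : ℚ) / (M : ℚ)) *
    ∑ d' ∈ M.divisors.filter (fun d' => d * d' ∣ M),
      (ArithmeticFunction.moebius d' : ℚ) * multinomialQ M k (d * d')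

/-- `[n]_q = 1 + q + ⋯ + q^{n−1}` in `ℤ[q]`. -/
def qNat (n : ℕ) : Polynomial ℤ := ∑ i ∈ Finset.range n, X ^ i

/-- `[n]_q! = [n]_q [n−1]_q ⋯ [1]_q`. -/
def qFactorial (n : ℕ) : Polynomial ℤ := ∏ i ∈ Finset.range n, qNat (i + 1)

/-- The Gaussian multinomial `[n; k_1,…,k_r]_q = [n]_q!/([k_1]_q! ⋯ [k_r]_q!)`
(an exact division of polynomials, performed here as division by a monic
polynomial), with the convention that it is `0` if `n ≠ k_1 + ⋯ + k_r`. -/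
def qMultinomial {ι : Type} [Fintype ι] (n : ℕ) (k : ι → ℕ) : Polynomial ℤ :=
  if ∑ j, k j = n then qFactorial n /ₘ ∏ j, qFactorial (k j) else 0

end

theorem mem_desc {ℓ m : ℕ} {w : Fin m → ZMod (ℓ + 1)} {r : Fin m} :
    r ∈ desc w ↔ ∃ h : (r : ℕ) + 1 < m, (w ⟨(r : ℕ) + 1, h⟩).val < (w r).val := by
  simp [desc]

theorem Rf_sub_Rf_succ {ℓ m : ℕ} (i : ZMod (ℓ + 1)) (w : Fin m → ZMod (ℓ + 1)) {p q : Fin m}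
    (hpq : (p : ℕ) + 1 = q) :
    Rf i w p - Rf i w q = (if i = w p then 1 else 0) - (if i = w q + 1 then 1 else 0) := by
  have hins : univ.filter (fun s : Fin m => p < s) =
      insert q (univ.filter (fun s : Fin m => q < s)) := by
    ext s
    simp only [mem_filter, mem_univ, true_and, mem_insert, Fin.lt_def, Fin.ext_iff]
    omega
  unfold Rf
  rw [hins, sum_insert (by simp)]
  ring

theorem Rf_le_eps {ℓ m : ℕ} (i : ZMod (ℓ + 1)) (w : Fin m → ZMod (ℓ + 1)) (p : Fin m) :
    Rf i w p ≤ eps i w := by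
  have h : (Rf i w p).toNat ≤ eps i w :=
    le_sup (f := fun p => (Rf i w p).toNat) (mem_univ p)
  omega

/-- The signature rule: `f_i` replaces a letter `i - 1` whose right neighbour in the tuple is
not `i - 1` and whose left neighbour is not `i`. -/
theorem exists_update_of_fOp_eq_some {ℓ m : ℕ} (hℓ : 1 ≤ ℓ) {i : ZMod (ℓ + 1)}
    {w w' : Fin m → ZMod (ℓ + 1)} (h : fOp i w = some w') :
    ∃ p : Fin m, w p = i - 1 ∧ w' = Function.update w p i ∧
      (∀ q : Fin m, (p : ℕ) + 1 = q → w q ≠ i - 1) ∧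
      (∀ q : Fin m, (q : ℕ) + 1 = p → w q ≠ i) := by
  have : Fact (1 < ℓ + 1) := ⟨by omega⟩
  unfold fOp at h
  rcases hmin : (univ.filter fun p => Rf i w p = (eps i w : ℤ)).min with _ | p
  · rw [hmin] at h
    exact absurd h (by simp [WithTop.recTopCoe])
  rw [hmin] at h
  change (if w p = i - 1 then some (Function.update w p i) else none) = some w' at h
  split_ifs at h with hp
  have hRp : Rf i w p = eps i w := (mem_filter.mp (mem_of_min hmin)).2
  refine ⟨p, hp, (Option.some.inj h).symm, fun q hq hwq => ?_, fun q hq hwq => ?_⟩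
  · have hsub := Rf_sub_Rf_succ i w hq
    have hle := Rf_le_eps i w q
    have hne : i ≠ i - 1 := fun he => one_ne_zero (sub_eq_self.mp he.symm)
    rw [hp, hwq, if_neg hne, if_pos (sub_add_cancel i 1).symm] at hsub
    omega
  · have hsub := Rf_sub_Rf_succ i w hq
    rw [hp, hwq, if_pos rfl, if_pos (sub_add_cancel i 1).symm] at hsub
    have hRq : Rf i w q = eps i w := by omega
    have hle : p ≤ q := min_le_of_eq (mem_filter.mpr ⟨mem_univ q, hRq⟩) hmin
    rw [Fin.le_def] at hle
    omega

theorem Nfun_add_MajFun {ℓ m : ℕ} (w : Fin m → ZMod (ℓ + 1)) :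
    Nfun w + MajFun w = m + (desc w).card * m := by
  have hN : Nfun w = m + ∑ r ∈ desc w, (m - 1 - (r : ℕ)) := by
    simp only [Nfun, sum_add_distrib, card_filter]
    rw [sum_comm]
    simp [← Fin.card_Ioi, ← Finset.filter_lt_eq_Ioi]
  rw [hN, MajFun, add_assoc, ← sum_add_distrib,
    sum_congr rfl (g := fun _ => m) (fun r _ => by omega)]
  simp

theorem natCast_Nfun {ℓ m : ℕ} (w : Fin m → ZMod (ℓ + 1)) :
    (Nfun w : ZMod m) = -(MajFun w : ZMod m) := by
  have h := congrArg (Nat.cast : ℕ → ZMod m) (Nfun_add_MajFun w)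
  push_cast at h
  simpa [eq_neg_iff_add_eq_zero] using h

theorem natCast_MajFun {ℓ m : ℕ} (w : Fin m → ZMod (ℓ + 1)) :
    (MajFun w : ZMod m) = ∑ r : Fin m, if r ∈ desc w then ((r : ℕ) + 1 : ZMod m) else 0 := by
  simp [MajFun, sum_ite_mem]

theorem desc_update_of_ne_zero {ℓ m : ℕ} (hℓ : 1 ≤ ℓ) {i : ZMod (ℓ + 1)} (hi : i ≠ 0)
    {w : Fin m → ZMod (ℓ + 1)} {p : Fin m} (hp : w p = i - 1)
    (hnext : ∀ q : Fin m, (p : ℕ) + 1 = q → w q ≠ i - 1)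
    (hprev : ∀ q : Fin m, (q : ℕ) + 1 = p → w q ≠ i) :
    desc (Function.update w p i) = desc w := by
  have : Fact (1 < ℓ + 1) := ⟨by omega⟩
  have hipos : 0 < i.val := Nat.pos_of_ne_zero ((ZMod.val_ne_zero i).mpr hi)
  have hval : (i - 1).val = i.val - 1 := by
    rw [ZMod.val_sub (by rw [ZMod.val_one]; omega), ZMod.val_one]
  ext r
  rw [mem_desc, mem_desc]
  refine exists_congr fun h => ?_
  by_cases hr : r = p
  · subst hr
    have hq : (⟨(r : ℕ) + 1, h⟩ : Fin m) ≠ r := by simp [Fin.ext_iff]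
    have hne : (w ⟨(r : ℕ) + 1, h⟩).val ≠ (i - 1).val :=
      fun he => hnext ⟨(r : ℕ) + 1, h⟩ rfl (ZMod.val_injective _ he)
    rw [Function.update_self, Function.update_of_ne hq, hp]
    omega
  · rw [Function.update_of_ne hr]
    by_cases hr' : (⟨(r : ℕ) + 1, h⟩ : Fin m) = p
    · have hne : (w r).val ≠ i.val :=
        fun he => hprev r (congrArg Fin.val hr') (ZMod.val_injective _ he)
      rw [hr', Function.update_self, hp]
      omega
    · rw [Function.update_of_ne hr']

theorem natCast_MajFun_update_zero {ℓ m : ℕ}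
    {w : Fin m → ZMod (ℓ + 1)} {p : Fin m} (hp : w p = 0 - 1)
    (hnext : ∀ q : Fin m, (p : ℕ) + 1 = q → w q ≠ 0 - 1)
    (hprev : ∀ q : Fin m, (q : ℕ) + 1 = p → w q ≠ 0) :
    (MajFun (Function.update w p 0) : ZMod m) = MajFun w - 1 := by
  have hval : (0 - 1 : ZMod (ℓ + 1)).val = ℓ := by
    rw [zero_sub]; exact ZMod.val_neg_one ℓ
  have hdiff : ∀ r : Fin m,
      (if r ∈ desc (Function.update w p 0) then ((r : ℕ) + 1 : ZMod m) else 0) =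
        (if r ∈ desc w then ((r : ℕ) + 1 : ZMod m) else 0) +
        ((if (r : ℕ) + 1 = p then ((p : ℕ) : ZMod m) else 0) -
          (if r = p then ((p : ℕ) + 1 : ZMod m) else 0)) := by
    intro r
    simp only [mem_desc]
    by_cases hr : r = p
    · subst hr
      by_cases h : (r : ℕ) + 1 < m
      · have hq : (⟨(r : ℕ) + 1, h⟩ : Fin m) ≠ r := by simp [Fin.ext_iff]
        have hne : (w ⟨(r : ℕ) + 1, h⟩).val ≠ (0 - 1 : ZMod (ℓ + 1)).val :=
          fun he => hnext ⟨(r : ℕ) + 1, h⟩ rfl (ZMod.val_injective _ he)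
        have hlt := ZMod.val_lt (w ⟨(r : ℕ) + 1, h⟩)
        have hdesc : (w ⟨(r : ℕ) + 1, h⟩).val < (0 - 1 : ZMod (ℓ + 1)).val := by omega
        simp [h, hp, hdesc, -zero_sub]
      · have hm : (r : ℕ) + 1 = m := by omega
        have hcast : ((r : ℕ) + 1 : ZMod m) = 0 := by
          exact_mod_cast (congrArg (Nat.cast : ℕ → ZMod m) hm).trans (ZMod.natCast_self m)
        simp [h, hcast]
    · by_cases hr' : (r : ℕ) + 1 = p
      · have h : (r : ℕ) + 1 < m := hr' ▸ p.isLt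
        have hp' : (⟨(r : ℕ) + 1, h⟩ : Fin m) = p := Fin.ext hr'
        have hpos : 0 < (w r).val :=
          Nat.pos_of_ne_zero ((ZMod.val_ne_zero _).mpr (hprev r hr'))
        have hle : ¬ ℓ < (w r).val := by have := ZMod.val_lt (w r); omega
        rw [← hr']
        simp [hp', hp, hval, hle, hpos, hr, h, -zero_sub]
      · have hne (h : (r : ℕ) + 1 < m) : (⟨(r : ℕ) + 1, h⟩ : Fin m) ≠ p :=
          fun he => hr' (congrArg Fin.val he)
        simp [hr, hr', hne]
  have hsum : ∑ r : Fin m, (if (r : ℕ) + 1 = p then ((p : ℕ) : ZMod m) else 0) = (p : ℕ) := by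
    rw [Fin.sum_univ_eq_sum_range (fun r => if r + 1 = (p : ℕ) then ((p : ℕ) : ZMod m) else 0)]
    rcases hp0 : (p : ℕ) with _ | k
    · simp
    · have hk : k < m := by omega
      simp [hk]
  rw [natCast_MajFun, natCast_MajFun, sum_congr rfl fun r _ => hdiff r, sum_add_distrib,
    sum_sub_distrib, hsum]
  simp
  ring

theorem natCast_Nfun_of_fOp_eq_some {ℓ m : ℕ} (hℓ : 1 ≤ ℓ) {i : ZMod (ℓ + 1)}
    {w w' : Fin m → ZMod (ℓ + 1)} (h : fOp i w = some w') :
    (Nfun w' : ZMod m) = Nfun w + if i = 0 then 1 else 0 := by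
  obtain ⟨p, hp, rfl, hnext, hprev⟩ := exists_update_of_fOp_eq_some hℓ h
  rw [natCast_Nfun, natCast_Nfun]
  split_ifs with hi
  · subst hi
    rw [natCast_MajFun_update_zero hp hnext hprev]
    ring
  · rw [MajFun, MajFun, desc_update_of_ne_zero hℓ hi hp hnext hprev, add_zero]

theorem natCast_Nfun_of_applyList_eq_some {ℓ m : ℕ} (hℓ : 1 ≤ ℓ) (is : List (ZMod (ℓ + 1)))
    {w w' : Fin m → ZMod (ℓ + 1)} (h : applyList fOp is w = some w') :
    (Nfun w' : ZMod m) = Nfun w + (is.count 0 : ℕ) := by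
  induction is generalizing w with
  | nil =>
    obtain rfl : w = w' := Option.some.inj h
    simp
  | cons i is ih =>
    obtain ⟨v, hv, hvw⟩ := Option.bind_eq_some_iff.mp h
    rw [ih hvw, natCast_Nfun_of_fOp_eq_some hℓ hv, List.count_cons]
    by_cases hi : i = 0 <;> simp [hi]
    ring

/-- if `w` is obtained from the constant word `(0,…,0)` by the
successive application of `f_{i_1}, …, f_{i_k}` (all applications being
defined), then the number of `t` with `i_t = 0` is congruent to `N(w)`
modulo `m`; in particular this residue class does not depend on the chosen
sequence. -/
theorem stmt_6 (ℓ m : ℕ) (hℓ : 1 ≤ ℓ) (hm : 1 ≤ m)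
    (is : List (ZMod (ℓ + 1))) (w : Fin m → ZMod (ℓ + 1))
    (h : applyList fOp is (fun _ => 0) = some w) :
    is.count 0 ≡ Nfun w [MOD m] := by
  have hcount := natCast_Nfun_of_applyList_eq_some hℓ is h
  have hzero : (Nfun (fun _ : Fin m => (0 : ZMod (ℓ + 1))) : ZMod m) = 0 := by
    simp [natCast_Nfun, MajFun, desc]
  rw [hzero, zero_add] at hcount
  exact ((ZMod.natCast_eq_natCast_iff _ _ _).mp hcount).symm

end GreensteinPaths
end

section
/- Every word w of length m can be obtained from the constant word (0,0,…,0) by successively applying finitely many operators f_i (i ∈ I), all applications being defined; and every word w of length m can likewise be obtained from (0,0,…,0) by successively applying finitely many operators e_i (i ∈ I), all applications being defined. -/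
open Finset Polynomial

namespace GreensteinPaths

noncomputable section

attribute [local instance] Classical.propDecidable

variable {ℓ m : ℕ}

end

/-- Position `p` is the largest maximizer of `R^i` on `w`, carries the letter `i`, and `w'` is
obtained from `w` by lowering it. -/
def IsEStep {ℓ m : ℕ} (i : ZMod (ℓ + 1)) (w w' : Fin m → ZMod (ℓ + 1)) : Prop :=
  ∃ p, (∀ q, Rf i w q ≤ Rf i w p) ∧ (∀ q, p < q → Rf i w q < Rf i w p) ∧ w p = i ∧
    w' = Function.update w p (i - 1)

/-- Position `p` is the smallest maximizer of `R^i` on `w`, carries the letter `i - 1`, and `w'`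
is obtained from `w` by raising it. -/
def IsFStep {ℓ m : ℕ} (i : ZMod (ℓ + 1)) (w w' : Fin m → ZMod (ℓ + 1)) : Prop :=
  ∃ p, (∀ q, Rf i w q ≤ Rf i w p) ∧ (∀ q, q < p → Rf i w q < Rf i w p) ∧ w p = i - 1 ∧
    w' = Function.update w p i

/-- The contribution of a letter to `R^i` at all positions to its right. -/
def weight {ℓ : ℕ} (i x : ZMod (ℓ + 1)) : ℤ :=
  (if i = x then 1 else 0) - (if i = x + 1 then 1 else 0)

/-- Reverse a word and negate its letters. -/
def flipWord {ℓ m : ℕ} (w : Fin m → ZMod (ℓ + 1)) : Fin m → ZMod (ℓ + 1) :=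
  fun p => -w p.rev

section

variable {ℓ m : ℕ} {i : ZMod (ℓ + 1)} {w w' : Fin m → ZMod (ℓ + 1)}

theorem Rf_eq (i : ZMod (ℓ + 1)) (w : Fin m → ZMod (ℓ + 1)) (p : Fin m) :
    Rf i w p = (if i = w p then 1 else 0) + ∑ s with p < s, weight i (w s) := by
  unfold Rf weight
  congr!

theorem eps_eq_of_forall_le {p : Fin m} (h : ∀ q, Rf i w q ≤ Rf i w p) :
    (eps i w : ℤ) = Rf i w p := by
  have hm : 0 < m := p.pos
  have hlast : 0 ≤ Rf i w ⟨m - 1, by omega⟩ := by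
    have : (univ.filter fun s : Fin m => (⟨m - 1, by omega⟩ : Fin m) < s) = ∅ := by
      ext s
      simp only [mem_filter, mem_univ, true_and, Fin.lt_def, notMem_empty, iff_false]
      omega
    rw [Rf_eq, this, sum_empty]
    split_ifs <;> simp
  have hp : 0 ≤ Rf i w p := hlast.trans (h _)
  have : eps i w = (Rf i w p).toNat := by
    apply le_antisymm
    · exact Finset.sup_le fun q _ => Int.toNat_le_toNat (h q)
    · exact Finset.le_sup (f := fun p => (Rf i w p).toNat) (mem_univ p)
  rw [this, Int.toNat_of_nonneg hp]

theorem IsEStep.eOp_eq (h : IsEStep i w w') : eOp i w = some w' := by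
  obtain ⟨p, hp, hlt, hi, rfl⟩ := h
  have hmax : (univ.filter fun q => Rf i w q = (eps i w : ℤ)).max = (p : WithBot (Fin m)) := by
    rw [eps_eq_of_forall_le hp]
    apply le_antisymm
    · refine Finset.max_le fun q hq => ?_
      by_contra hpq
      exact (hlt q (by simpa using hpq)).ne (by simpa using hq)
    · exact Finset.le_max (by simp)
  unfold eOp
  convert_to (if w p = i then some (Function.update w p (i - 1)) else none) = _
  · rw [show (univ.filter fun q => Rf i w q = (eps i w : ℤ)).max = _ from by convert hmax]
    simp
  · simp [hi]

theorem IsFStep.fOp_eq (h : IsFStep i w w') : fOp i w = some w' := by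
  obtain ⟨p, hp, hlt, hi, rfl⟩ := h
  have hmin : (univ.filter fun q => Rf i w q = (eps i w : ℤ)).min = (p : WithTop (Fin m)) := by
    rw [eps_eq_of_forall_le hp]
    apply le_antisymm
    · exact Finset.min_le (by simp)
    · refine Finset.le_min fun q hq => ?_
      by_contra hpq
      exact (hlt q (by simpa using hpq)).ne (by simpa using hq)
  unfold fOp
  convert_to (if w p = i - 1 then some (Function.update w p i) else none) = _
  · rw [show (univ.filter fun q => Rf i w q = (eps i w : ℤ)).min = _ from by convert hmin]
    simp
  · simp [hi]

theorem weight_self [Nontrivial (ZMod (ℓ + 1))] : weight i i = 1 := by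
  simp [weight]

theorem weight_sub_one [Nontrivial (ZMod (ℓ + 1))] : weight i (i - 1) = -1 := by
  have : ¬ i = i - 1 := fun h => one_ne_zero (sub_eq_self.mp h.symm)
  simp [weight, this]

theorem IsEStep.isFStep [Nontrivial (ZMod (ℓ + 1))] (h : IsEStep i w w') : IsFStep i w' w := by
  obtain ⟨p, hp, hlt, hi, rfl⟩ := h
  have hne : ¬ i = i - 1 := fun h => one_ne_zero (sub_eq_self.mp h.symm)
  have hsum : ∀ q, ∑ s with q < s, weight i (Function.update w p (i - 1) s) =
      (∑ s with q < s, weight i (w s)) + if q < p then -2 else 0 := by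
    intro q
    rw [← sub_eq_iff_eq_add', ← Finset.sum_sub_distrib,
      Finset.sum_congr rfl (g := fun s => if p = s then (-2 : ℤ) else 0), Finset.sum_ite_eq]
    · simp
    · intro s _
      by_cases hs : p = s
      · subst hs
        simp [hi, weight_self, weight_sub_one]
      · simp [hs, Function.update_of_ne (Ne.symm hs)]
  have hpp : Rf i (Function.update w p (i - 1)) p = Rf i w p - 1 := by
    rw [Rf_eq, Rf_eq, hsum]
    simp [hi, hne]
  have hgt : ∀ q, p < q → Rf i (Function.update w p (i - 1)) q = Rf i w q := by
    intro q hq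
    rw [Rf_eq, Rf_eq, hsum]
    simp [hq.ne', hq.not_gt]
  have hless : ∀ q, q < p → Rf i (Function.update w p (i - 1)) q = Rf i w q - 2 := by
    intro q hq
    rw [Rf_eq, Rf_eq, hsum]
    simp only [hq, Function.update_of_ne hq.ne, if_true]
    ring
  refine ⟨p, fun q => ?_, fun q hq => ?_, by simp, by simp [← hi]⟩
  · rcases lt_trichotomy p q with hq | rfl | hq
    · have := hlt q hq
      rw [hgt q hq, hpp]
      omega
    · rfl
    · have := hp q
      rw [hless q hq, hpp]
      omega
  · have := hp q
    rw [hless q hq, hpp]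
    omega

theorem Rf_flipWord (i : ZMod (ℓ + 1)) (w : Fin m → ZMod (ℓ + 1)) (p : Fin m) :
    Rf (1 - i) (flipWord w) p.rev = Rf i w p - ∑ s, weight i (w s) := by
  have hw : ∀ x : ZMod (ℓ + 1), weight (1 - i) (-x) = -weight i x := by
    intro x
    have h1 : 1 - i = -x ↔ i = x + 1 := by grind
    have h2 : 1 - i = -x + 1 ↔ i = x := by grind
    simp [weight, h1, h2]
  have hsum : ∑ s with p.rev < s, weight (1 - i) (flipWord w s) =
      - ∑ s with s < p, weight i (w s) := by
    rw [← Finset.sum_neg_distrib]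
    refine Finset.sum_nbij' Fin.rev Fin.rev ?_ ?_ ?_ ?_ ?_
    · intro s hs
      simpa [Fin.rev_lt_iff] using hs
    · intro s hs
      simpa [Fin.rev_lt_rev] using hs
    · simp
    · simp
    · simp [flipWord, hw]
  have hsplit : ∑ s, weight i (w s) = (∑ s with s < p, weight i (w s)) + weight i (w p) +
      ∑ s with p < s, weight i (w s) := by
    rw [← Finset.sum_filter_add_sum_filter_not univ (fun s => s < p), add_assoc]
    congr 1
    have : (univ.filter fun s => ¬ s < p) = insert p (univ.filter fun s => p < s) := by
      ext s
      simp [le_iff_eq_or_lt, eq_comm]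
    rw [this, Finset.sum_insert (by simp)]
  have h1 : 1 - i = -w p ↔ i = w p + 1 := by grind
  rw [Rf_eq, Rf_eq, hsum, hsplit]
  simp only [flipWord, Fin.rev_rev, h1, weight]
  ring

theorem flipWord_update (p : Fin m) (x : ZMod (ℓ + 1)) :
    flipWord (Function.update w p x) = Function.update (flipWord w) p.rev (-x) := by
  funext s
  by_cases hs : s = p.rev
  · subst hs
    simp [flipWord]
  · have : s.rev ≠ p := fun h => hs (by simp [← h])
    simp [flipWord, hs, this]

theorem IsFStep.isEStep_flipWord (h : IsFStep i w w') :
    IsEStep (1 - i) (flipWord w) (flipWord w') := by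
  obtain ⟨p, hp, hlt, hi, rfl⟩ := h
  refine ⟨p.rev, fun q => ?_, fun q hq => ?_, ?_, ?_⟩
  · have := hp q.rev
    rw [← Fin.rev_rev q, Rf_flipWord, Rf_flipWord]
    omega
  · have := hlt q.rev (by simpa [Fin.rev_lt_iff] using hq)
    rw [← Fin.rev_rev q, Rf_flipWord, Rf_flipWord]
    omega
  · simp [flipWord, hi]
  · rw [flipWord_update]
    congr 1
    ring

theorem flipWord_flipWord (w : Fin m → ZMod (ℓ + 1)) : flipWord (flipWord w) = w := by
  funext p
  simp [flipWord]

/-- Each letter contributes to `R^i` relative to its right neighbour. -/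
theorem Rf_eq_succ (i : ZMod (ℓ + 1)) (w : Fin m → ZMod (ℓ + 1)) (p q : Fin m)
    (h : (q : ℕ) = p + 1) :
    Rf i w p = Rf i w q + (if i = w p then 1 else 0) - (if i = w q + 1 then 1 else 0) := by
  have : (univ.filter fun s => p < s) = insert q (univ.filter fun s => q < s) := by
    ext s
    simp only [mem_filter, mem_univ, true_and, mem_insert, Fin.lt_def, Fin.ext_iff]
    omega
  rw [Rf_eq, Rf_eq, this, Finset.sum_insert (by simp), weight]
  ring

theorem exists_isEStep [Nontrivial (ZMod (ℓ + 1))] (j : Fin m) (hj : ∀ p, j ≤ p → w p = i) :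
    ∃ p ≤ j, w p = i ∧ IsEStep i w (Function.update w p (i - 1)) := by
  obtain ⟨p, -, hp⟩ := Finset.exists_max_image univ (fun p => toLex (Rf i w p, p)) ⟨j, mem_univ j⟩
  have hle : ∀ q, Rf i w q ≤ Rf i w p := by
    intro q
    rcases Prod.Lex.le_iff.mp (hp q (mem_univ q)) with h | h
    · exact le_of_lt h
    · exact le_of_eq h.1
  have hlt : ∀ q, p < q → Rf i w q < Rf i w p := by
    intro q hq
    rcases Prod.Lex.le_iff.mp (hp q (mem_univ q)) with h | h
    · exact h
    · exact absurd h.2 hq.not_ge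
  have hpj : p ≤ j := by
    by_contra! hjp
    have hjp' : (j : ℕ) < p := hjp
    have hp0 : (p : ℕ) - 1 < m := by omega
    have hR := Rf_eq_succ i w ⟨p - 1, hp0⟩ p (by simp only; omega)
    have h1 : w ⟨p - 1, hp0⟩ = i := hj _ (by rw [Fin.le_def]; simp only; omega)
    have h2 : w p = i := hj _ hjp.le
    have := hle ⟨p - 1, hp0⟩
    simp only [h1, h2, left_eq_add, one_ne_zero, if_true, if_false] at hR
    omega
  have hpi : w p = i := by
    by_contra hne
    have hpj' : (p : ℕ) < j := lt_of_le_of_ne hpj fun h => hne (hj p (Fin.ext h).ge)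
    have hR := Rf_eq_succ i w p ⟨p + 1, by omega⟩ rfl
    have := hlt ⟨p + 1, by omega⟩ (by simp [Fin.lt_def])
    rw [if_neg (Ne.symm hne)] at hR
    split_ifs at hR <;> omega
  exact ⟨p, hpj, hpi, p, hle, hlt, hpi, rfl⟩

/-- One word is obtained from another by finitely many applications of the `e_i`. -/
def EReach {ℓ m : ℕ} : (Fin m → ZMod (ℓ + 1)) → (Fin m → ZMod (ℓ + 1)) → Prop :=
  Relation.ReflTransGen fun w w' => ∃ i, IsEStep i w w'

theorem exists_eReach_lower_of_partial [Nontrivial (ZMod (ℓ + 1))] (c : ZMod (ℓ + 1)) (j : ℕ)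
    (n : ℕ) : ∀ (w : Fin m → ZMod (ℓ + 1)) (k : ℕ), content w c = n → j ≤ k →
      (∀ p : Fin m, k ≤ p → w p = c) → (∀ p : Fin m, j ≤ p → (p : ℕ) < k → w p = c - 1) →
      ∃ w', EReach w w' ∧ (∀ p : Fin m, j ≤ p → w' p = c - 1) ∧ ∀ p, w p ≠ c → w' p = w p := by
  have hne : c - 1 ≠ c := fun h => one_ne_zero (sub_eq_self.mp h)
  induction n using Nat.strong_induction_on with
  | _ n ih =>
    intro w k hn hjk hk hjp
    by_cases hkm : k < m
    · obtain ⟨p, hpk, hpc, hstep⟩ := exists_isEStep (i := c) ⟨k, hkm⟩ fun p hp => hk p hp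
      have hpk' : (p : ℕ) ≤ k := hpk
      have hcont : content (Function.update w p (c - 1)) c < n := by
        rw [← hn]
        refine Finset.card_lt_card (Finset.ssubset_iff_of_subset ?_ |>.mpr ⟨p, ?_, ?_⟩)
        · intro q
          by_cases hq : q = p
          · subst hq
            simp [hpc]
          · simp [hq]
        · simpa using hpc
        · simp
      have hpcase : (p : ℕ) < j ∨ (p : ℕ) = k := by
        by_contra! h
        exact hne ((hjp p h.1 (lt_of_le_of_ne hpk' h.2)).symm.trans hpc)
      obtain ⟨w', hw', hlow, hkeep⟩ := ih _ hcont (Function.update w p (c - 1))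
        (if (p : ℕ) = k then k + 1 else k) rfl (by split_ifs <;> omega)
        (fun q hq => by
          have hqp : q ≠ p := by
            rintro rfl
            split_ifs at hq <;> omega
          rw [Function.update_of_ne hqp]
          exact hk q (by split_ifs at hq <;> omega))
        (fun q hq hqk => by
          by_cases hqp : q = p
          · simp [hqp]
          · rw [Function.update_of_ne hqp]
            have : (q : ℕ) ≠ p := fun h => hqp (Fin.ext h)
            exact hjp q hq (by split_ifs at hqk <;> omega))
      refine ⟨w', hw'.head ⟨c, hstep⟩, hlow, fun q hq => ?_⟩
      have hqp : q ≠ p := by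
        rintro rfl
        exact hq hpc
      simpa [hqp] using hkeep q (by simpa [hqp] using hq)
    · exact ⟨w, .refl, fun p hp => hjp p hp (by omega), fun _ _ => rfl⟩

theorem exists_eReach_lower [Nontrivial (ZMod (ℓ + 1))] {c : ZMod (ℓ + 1)} {j : ℕ}
    (h : ∀ p : Fin m, j ≤ p → w p = c) :
    ∃ w', EReach w w' ∧ (∀ p : Fin m, j ≤ p → w' p = c - 1) ∧ ∀ p, w p ≠ c → w' p = w p :=
  exists_eReach_lower_of_partial c j _ w j rfl le_rfl h fun _ h₁ h₂ => absurd h₁ h₂.not_ge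

theorem exists_eReach_extend [Nontrivial (ZMod (ℓ + 1))] (r : Fin m) (b : ZMod (ℓ + 1)) (n : ℕ) :
    ∀ w : Fin m → ZMod (ℓ + 1), w r = b → (∀ p, r < p → w p = b + n) →
      ∃ w', EReach w w' ∧ ∀ p, r ≤ p → w' p = b := by
  induction n with
  | zero =>
    intro w hr h
    refine ⟨w, .refl, fun p hp => ?_⟩
    rcases hp.eq_or_lt with rfl | hp
    · exact hr
    · simpa using h p hp
  | succ n ih =>
    intro w hr h
    by_cases hb : b = b + (n + 1 : ℕ)
    · refine ⟨w, .refl, fun p hp => ?_⟩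
      rcases hp.eq_or_lt with rfl | hp
      · exact hr
      · exact (h p hp).trans hb.symm
    · obtain ⟨w₁, h₁, hlow, hkeep⟩ := exists_eReach_lower (j := r + 1) h
      obtain ⟨w₂, h₂, hw₂⟩ := ih w₁ ((hkeep r (by rwa [hr])).trans hr) fun p hp => by
        rw [hlow p hp]
        push_cast
        ring
      exact ⟨w₂, h₁.trans h₂, hw₂⟩

theorem exists_eReach_const [Nontrivial (ZMod (ℓ + 1))] (w : Fin m → ZMod (ℓ + 1)) :
    ∃ (c : ZMod (ℓ + 1)), EReach w fun _ => c := by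
  suffices H : ∀ j ≤ m, ∃ (w' : Fin m → ZMod (ℓ + 1)) (c : ZMod (ℓ + 1)),
      EReach w w' ∧ ∀ p : Fin m, m ≤ p + j → w' p = c by
    obtain ⟨w', c, hr, hc⟩ := H m le_rfl
    obtain rfl : w' = fun _ => c := funext fun p => hc p (by omega)
    exact ⟨c, hr⟩
  intro j
  induction j with
  | zero => exact fun _ => ⟨w, 0, .refl, fun p hp => by omega⟩
  | succ j ih =>
    intro hj
    obtain ⟨w', c, hr, hc⟩ := ih (by omega)
    let r : Fin m := ⟨m - (j + 1), by omega⟩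
    obtain ⟨w'', hr', hb⟩ := exists_eReach_extend r (w' r) (c - w' r).val w' rfl fun p hp => by
      have hp' : m - (j + 1) < p := hp
      rw [hc p (by omega)]
      simp
    refine ⟨w'', w' r, hr.trans hr', fun p hp => hb p ?_⟩
    change m - (j + 1) ≤ (p : ℕ)
    omega

theorem eReach_zero [Nontrivial (ZMod (ℓ + 1))] (w : Fin m → ZMod (ℓ + 1)) :
    EReach w fun _ => 0 := by
  obtain ⟨c, hc⟩ := exists_eReach_const w
  suffices H : ∀ n : ℕ, EReach (m := m) (fun _ => (n : ZMod (ℓ + 1))) fun _ => 0 by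
    have h := H c.val
    rw [ZMod.natCast_zmod_val] at h
    exact hc.trans h
  intro n
  induction n with
  | zero =>
    rw [Nat.cast_zero]
    exact .refl
  | succ n ih =>
    obtain ⟨w', hr, hlow, -⟩ := exists_eReach_lower (m := m) (j := 0)
      (w := fun _ => ((n + 1 : ℕ) : ZMod (ℓ + 1))) fun _ _ => rfl
    obtain rfl : w' = fun _ => (n : ZMod (ℓ + 1)) := funext fun p => by simp [hlow p (by omega)]
    exact hr.trans ih

theorem exists_applyList_of_reflTransGen
    {op : ZMod (ℓ + 1) → (Fin m → ZMod (ℓ + 1)) → Option (Fin m → ZMod (ℓ + 1))}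
    (h : Relation.ReflTransGen (fun w w' => ∃ i, op i w = some w') w w') :
    ∃ is, applyList op is w = some w' := by
  induction h using Relation.ReflTransGen.head_induction_on with
  | refl => exact ⟨[], rfl⟩
  | head h _ ih =>
    obtain ⟨i, hi⟩ := h
    obtain ⟨is, his⟩ := ih
    exact ⟨i :: is, by simp [applyList, hi, his]⟩

theorem reflTransGen_isFStep_zero [Nontrivial (ZMod (ℓ + 1))] (w : Fin m → ZMod (ℓ + 1)) :
    Relation.ReflTransGen (fun w w' => ∃ i, IsFStep i w w') (fun _ => 0) w := by
  refine Relation.ReflTransGen.mono ?_ _ _ (Relation.ReflTransGen.swap _ _ (eReach_zero w))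
  rintro u v ⟨i, h⟩
  exact ⟨i, h.isFStep⟩

end

/-- every word of length `m` is obtained from the constant word
`(0,…,0)` by finitely many applications of the `f_i` (all defined), and
likewise by finitely many applications of the `e_i`. -/
theorem stmt_7 (ℓ m : ℕ) (hℓ : 1 ≤ ℓ) (hm : 1 ≤ m)
    (w : Fin m → ZMod (ℓ + 1)) :
    (∃ is : List (ZMod (ℓ + 1)), applyList fOp is (fun _ => 0) = some w) ∧
    (∃ is : List (ZMod (ℓ + 1)), applyList eOp is (fun _ => 0) = some w) := by
  have : Fact (1 < ℓ + 1) := ⟨by omega⟩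
  constructor
  · refine exists_applyList_of_reflTransGen
      (Relation.ReflTransGen.mono ?_ _ _ (reflTransGen_isFStep_zero w))
    rintro u v ⟨i, h⟩
    exact ⟨i, h.fOp_eq⟩
  · have h := (reflTransGen_isFStep_zero (flipWord w)).lift
      (p := fun u v => ∃ i, eOp i u = some v) flipWord (by
        rintro u v ⟨i, h⟩
        exact ⟨1 - i, h.isEStep_flipWord.eOp_eq⟩)
    have h0 : flipWord (fun _ : Fin m => (0 : ZMod (ℓ + 1))) = fun _ => 0 := by
      funext p
      simp [flipWord]
    rw [Function.onFun, flipWord_flipWord, h0] at h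
    exact exists_applyList_of_reflTransGen h


end GreensteinPaths
end
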